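/- Let k ≥ 2. Consider the action of the quaternionic torus Sp(1)^{k−1} on ℍ^k in which (g₁,…,g_{k−1}) sends (q₁,…,q_k) to (q₁g₁⁻¹, g₁q₂g₂⁻¹, …, g_{k−2}q_{k−1}g_{k−1}⁻¹, g_{k−1}q_k). Then the orbit space ℍ^k/Sp(1)^{k−1} is homeomorphic to ℝ^{k+3}. -/

import Mathlib

noncomputable section

def chainExt (k : ℕ) {G : Type*} [One G] (r : Fin (k - 1) → G) (j : ℕ) : G :=
  if h : 1 ≤ j ∧ j ≤ k - 1 then r ⟨j - 1, by omega⟩ else 1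

/-- The orbit relation of the chain action of the norm-one elements `S(𝕂)^{k-1}` on `𝕂^k`,
where `(g₁,…,g_{k-1})` sends `(q₁,…,q_k)` to `(q₁g₁⁻¹, g₁q₂g₂⁻¹, …, g_{k-1}q_k)`. -/
def chainRel (K : Type*) [DivisionRing K] [Norm K] (k : ℕ) (a b : Fin k → K) : Prop :=
  ∃ g : Fin (k - 1) → K, (∀ j, ‖g j‖ = 1) ∧
    ∀ i : Fin k, b i = chainExt k g (i : ℕ) * a i * (chainExt k g ((i : ℕ) + 1))⁻¹

section ChainAction

variable {K : Type*} [NormedDivisionRing K]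

/-- The ordered product of the entries, together with the differences of the norms of the entries
to the norm of the first one. -/
def chainInvariant (n : ℕ) (a : Fin (n + 1) → K) : K × (Fin n → ℝ) :=
  ((List.ofFn a).prod, fun j => ‖a j.succ‖ - ‖a 0‖)

lemma norm_prod_ofFn {m : ℕ} (a : Fin m → K) : ‖(List.ofFn a).prod‖ = ∏ i, ‖a i‖ := by
  induction m with
  | zero => simp
  | succ m ih => simp [List.ofFn_succ, Fin.prod_univ_succ, ih]

lemma prod_ofFn_twist {m : ℕ} (a : Fin m → K) (E : ℕ → K) (hE : ∀ j, E j ≠ 0) :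
    (List.ofFn fun i : Fin m => E i * a i * (E (i + 1))⁻¹).prod =
      E 0 * (List.ofFn a).prod * (E m)⁻¹ := by
  induction m generalizing E with
  | zero => simp [hE]
  | succ m ih =>
    have := ih (fun i => a i.succ) (fun j => E (j + 1)) fun j => hE _
    simp only [List.ofFn_succ, List.prod_cons, Fin.val_succ, Fin.val_zero, zero_add] at this ⊢
    rw [this]
    simp only [mul_assoc]
    rw [inv_mul_cancel_left₀ (hE 1)]

lemma exists_twist_of_norm_eq {m : ℕ} (a b : Fin m → K) (hab : ∀ i, ‖a i‖ = ‖b i‖)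
    {v : K} (hv : ‖v‖ = 1) :
    ∃ E : ℕ → K, (∀ j, ‖E j‖ = 1) ∧ E m = v ∧
      ∀ i : Fin m, b i = E i * a i * (E (i + 1))⁻¹ := by
  induction m with
  | zero => exact ⟨fun _ => v, fun _ => hv, rfl, fun i => i.elim0⟩
  | succ m ih =>
    obtain ⟨E, hE, hEm, h⟩ := ih (fun i => a i.succ) (fun i => b i.succ) fun i => hab _
    have hE0 : E 0 ≠ 0 := norm_ne_zero_iff.1 (by simp [hE])
    obtain ⟨u, hu, hu0⟩ : ∃ u : K, ‖u‖ = 1 ∧ b 0 = u * a 0 * (E 0)⁻¹ := by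
      by_cases ha : a 0 = 0
      · have hb : b 0 = 0 := by simpa [ha] using (hab 0).symm
        exact ⟨1, by simp, by simp [ha, hb]⟩
      · refine ⟨b 0 * E 0 * (a 0)⁻¹, ?_, ?_⟩
        · simp [hE, ← hab, ha]
        · rw [inv_mul_cancel_right₀ ha, mul_inv_cancel_right₀ hE0]
    refine ⟨fun j => Nat.casesOn j u E, fun j => by cases j <;> simp [hE, hu], hEm, fun i => ?_⟩
    cases i using Fin.cases with
    | zero => exact hu0
    | succ i => exact h i

lemma exists_twist {m : ℕ} (a b : Fin m → K) (hab : ∀ i, ‖a i‖ = ‖b i‖)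
    {u v : K} (hu : ‖u‖ = 1) (hv : ‖v‖ = 1)
    (h : u * (List.ofFn a).prod = (List.ofFn b).prod * v) :
    ∃ E : ℕ → K, (∀ j, ‖E j‖ = 1) ∧ E 0 = u ∧ E m = v ∧
      ∀ i : Fin m, b i = E i * a i * (E (i + 1))⁻¹ := by
  induction m generalizing u with
  | zero =>
    obtain rfl : u = v := by simpa using h
    exact ⟨fun _ => u, fun _ => hv, rfl, rfl, fun i => i.elim0⟩
  | succ m ih =>
    obtain ⟨E, hE, hEm, hE', h0⟩ : ∃ E : ℕ → K, (∀ j, ‖E j‖ = 1) ∧ E m = v ∧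
        (∀ i : Fin m, b i.succ = E i * a i.succ * (E (i + 1))⁻¹) ∧
        b 0 = u * a 0 * (E 0)⁻¹ := by
      by_cases ha : a 0 = 0
      · have hb : b 0 = 0 := by simpa [ha] using (hab 0).symm
        obtain ⟨E, hE, hEm, h'⟩ := exists_twist_of_norm_eq (fun i => a i.succ)
          (fun i => b i.succ) (fun i => hab _) hv
        exact ⟨E, hE, hEm, h', by simp [ha, hb]⟩
      · have hb : b 0 ≠ 0 := norm_ne_zero_iff.1 (by simpa [← hab] using ha)
        have hu0 : u ≠ 0 := norm_ne_zero_iff.1 (by simp [hu])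
        simp only [List.ofFn_succ, List.prod_cons] at h
        obtain ⟨E, hE, hE0, hEm, h'⟩ := ih (fun i => a i.succ) (fun i => b i.succ)
          (fun i => hab _) (u := (b 0)⁻¹ * u * a 0) (by simp [hu, hab, hb]) (by
            rw [mul_assoc, mul_assoc, h, mul_assoc, inv_mul_cancel_left₀ hb])
        refine ⟨E, hE, hEm, h', ?_⟩
        rw [hE0, mul_assoc (b 0)⁻¹, mul_inv_rev, inv_inv,
          mul_inv_cancel_left₀ (mul_ne_zero hu0 ha)]
    refine ⟨fun j => Nat.casesOn j u E, fun j => by cases j <;> simp [hE, hu], rfl, hEm,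
      fun i => ?_⟩
    cases i using Fin.cases with
    | zero => exact h0
    | succ i => exact hE' i

lemma chainInvariant_eq_of_chainRel {n : ℕ} {a b : Fin (n + 1) → K}
    (h : chainRel K (n + 1) a b) : chainInvariant n a = chainInvariant n b := by
  obtain ⟨g, hg, h⟩ := h
  have hE : ∀ j, ‖chainExt (n + 1) g j‖ = 1 := fun j => by
    unfold chainExt
    split_ifs <;> simp [hg]
  have hnorm : ∀ i, ‖b i‖ = ‖a i‖ := fun i => by simp [h i, hE]
  have hprod := prod_ofFn_twist a (chainExt (n + 1) g) fun j =>
    norm_ne_zero_iff.1 (by simp [hE])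
  have h0 : chainExt (n + 1) g 0 = 1 := by simp [chainExt]
  have h1 : chainExt (n + 1) g (n + 1) = 1 := by simp [chainExt]
  rw [← funext h, h0, h1] at hprod
  rw [one_mul, inv_one, mul_one] at hprod
  simp only [chainInvariant, hnorm, hprod]

lemma prod_lt_prod_of_forall_lt {ι : Type*} [Fintype ι] [Nonempty ι] {x y : ι → ℝ}
    (hy : ∀ i, 0 ≤ y i) (h : ∀ i, y i < x i) : ∏ i, y i < ∏ i, x i := by
  by_cases h0 : ∃ i, y i = 0
  · obtain ⟨i, hi⟩ := h0
    rw [Finset.prod_eq_zero (Finset.mem_univ i) hi]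
    exact Finset.prod_pos fun j _ => (hy j).trans_lt (h j)
  · push Not at h0
    exact Finset.prod_lt_prod_of_nonempty (fun i _ => (hy i).lt_of_ne' (h0 i)) (fun i _ => h i)
      Finset.univ_nonempty

lemma chainRel_of_chainInvariant_eq {n : ℕ} {a b : Fin (n + 1) → K}
    (h : chainInvariant n a = chainInvariant n b) : chainRel K (n + 1) a b := by
  obtain ⟨hp, hd⟩ := Prod.ext_iff.1 h
  simp only [chainInvariant] at hp hd
  have hd' : ∀ i, ‖a i‖ - ‖a 0‖ = ‖b i‖ - ‖b 0‖ := fun i => by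
    cases i using Fin.cases with
    | zero => simp
    | succ i => exact congrFun hd i
  have hN : ∏ i, ‖a i‖ = ∏ i, ‖b i‖ := by rw [← norm_prod_ofFn, hp, norm_prod_ofFn]
  have h0 : ‖a 0‖ = ‖b 0‖ := by
    rcases lt_trichotomy ‖a 0‖ ‖b 0‖ with hlt | heq | hlt
    · exact absurd hN
        (prod_lt_prod_of_forall_lt (fun i => norm_nonneg (a i)) fun i => by linarith [hd' i]).ne
    · exact heq
    · exact absurd hN
        (prod_lt_prod_of_forall_lt (fun i => norm_nonneg (b i)) fun i => by linarith [hd' i]).ne'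
  obtain ⟨E, hE, hE0, hEm, hEi⟩ := exists_twist a b (fun i => by linarith [hd' i])
    (u := 1) (v := 1) (by simp) (by simp) (by rw [hp, one_mul, mul_one])
  have hext : ∀ j ≤ n + 1, chainExt (n + 1) (fun j : Fin n => E (j + 1)) j = E j := by
    intro j hj
    unfold chainExt
    split_ifs with hj'
    · simp [Nat.sub_add_cancel hj'.1]
    · obtain rfl | rfl : j = 0 ∨ j = n + 1 := by omega
      · exact hE0.symm
      · exact hEm.symm
  refine ⟨fun j : Fin n => E (j + 1), fun j => hE _, fun i => ?_⟩
  rw [hext _ (by omega), hext _ (by omega)]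
  exact hEi i

lemma norm_le_chainInvariant {n : ℕ} (a : Fin (n + 1) → K) :
    ‖a‖ ≤ 3 * ‖chainInvariant n a‖ + 1 := by
  set M := ‖chainInvariant n a‖
  have hM : 0 ≤ M := norm_nonneg _
  have hd : ∀ i, |‖a i‖ - ‖a 0‖| ≤ M := fun i => by
    cases i using Fin.cases with
    | zero => simpa using hM
    | succ i => exact (norm_le_pi_norm (chainInvariant n a).2 i).trans (norm_snd_le _)
  have hp : ∏ i, ‖a i‖ ≤ M := (norm_prod_ofFn a).symm.trans_le (norm_fst_le (chainInvariant n a))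
  obtain ⟨j, hj⟩ : ∃ j, ‖a j‖ ≤ M + 1 := by
    by_contra! hj
    have h1 : (M + 1) ^ (n + 1) ≤ ∏ i, ‖a i‖ := by
      simpa using Finset.prod_le_prod (s := Finset.univ) (f := fun _ : Fin (n + 1) => M + 1)
        (fun i _ => by positivity) fun i _ => (hj i).le
    have h2 : M + 1 ≤ (M + 1) ^ (n + 1) := le_self_pow₀ (by linarith) (by simp)
    linarith
  refine (pi_norm_le_iff_of_nonneg (by positivity)).2 fun i => ?_
  linarith [(abs_le.1 (hd i)).2, (abs_le.1 (hd j)).1]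

lemma exists_prod_add_eq {ι : Type*} [Fintype ι] [Nonempty ι] (c : ι → ℝ) {s : ℝ} (hs : 0 ≤ s) :
    ∃ t : ℝ, (∀ i, 0 ≤ t + c i) ∧ ∏ i, (t + c i) = s := by
  obtain ⟨m, hm⟩ := Finite.exists_min c
  have hc : Continuous fun t : ℝ => ∏ i, (t + c i) := by fun_prop
  obtain ⟨t, ht, hts⟩ := intermediate_value_Icc (a := -c m) (b := -c m + (1 + s)) (by linarith)
    hc.continuousOn (show s ∈ Set.Icc _ _ from ⟨by
      rw [Finset.prod_eq_zero (Finset.mem_univ m) (by simp)]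
      exact hs, by
      have h1 : (1 + s) ^ Fintype.card ι ≤ ∏ i, (-c m + (1 + s) + c i) := by
        simpa using Finset.prod_le_prod (s := Finset.univ) (f := fun _ : ι => 1 + s)
          (fun i _ => by positivity) fun i _ => by linarith [hm i]
      have h2 : 1 + s ≤ (1 + s) ^ Fintype.card ι := le_self_pow₀ (by linarith) (by simp)
      linarith⟩)
  exact ⟨t, fun i => by linarith [hm i, ht.1], hts⟩

lemma continuous_chainInvariant (n : ℕ) :
    Continuous (chainInvariant n : (Fin (n + 1) → K) → K × (Fin n → ℝ)) := by
  have h : ∀ m, Continuous fun a : Fin m → K => (List.ofFn a).prod := by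
    intro m
    induction m with
    | zero => simpa using continuous_const
    | succ m ih =>
      simp only [List.ofFn_succ, List.prod_cons]
      exact (continuous_apply 0).mul
        (ih.comp (g := fun a : Fin m → K => (List.ofFn a).prod) (by fun_prop))
  exact (h _).prodMk (by fun_prop)

variable [NormedAlgebra ℝ K]

lemma surjective_chainInvariant (n : ℕ) :
    Function.Surjective (chainInvariant n : (Fin (n + 1) → K) → K × (Fin n → ℝ)) := by
  rintro ⟨p, d⟩
  obtain ⟨t, ht, hp⟩ := exists_prod_add_eq (Fin.cons 0 d : Fin (n + 1) → ℝ) (norm_nonneg p)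
  obtain ⟨u, hu, hup⟩ : ∃ u : K, ‖u‖ = 1 ∧ ‖p‖ • u = p := by
    by_cases h : p = 0
    · exact ⟨1, by simp, by simp [h]⟩
    · have := norm_ne_zero_iff.2 h
      exact ⟨‖p‖⁻¹ • p, by simp [norm_smul, this], by simp [smul_smul, this]⟩
  have ht0 : 0 ≤ t := by simpa using ht 0
  have hts : ∀ j, 0 ≤ t + d j := fun j => by simpa using ht j.succ
  refine ⟨Fin.cons (t • u) fun j => algebraMap ℝ K (t + d j), ?_⟩
  have hprod : (List.ofFn fun j => algebraMap ℝ K (t + d j)).prod =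
      algebraMap ℝ K (∏ j, (t + d j)) := by
    rw [← List.prod_ofFn, map_list_prod, List.map_ofFn]
    rfl
  refine Prod.ext ?_ (funext fun j => ?_)
  · simp only [chainInvariant, List.ofFn_succ, List.prod_cons, Fin.cons_zero, Fin.cons_succ]
    rw [hprod, ← Algebra.commutes, ← Algebra.smul_def, smul_smul, mul_comm]
    rw [Fin.prod_univ_succ] at hp
    simp only [Fin.cons_zero, Fin.cons_succ, add_zero] at hp
    rw [hp, hup]
  · simp only [chainInvariant, Fin.cons_zero, Fin.cons_succ]
    rw [norm_algebraMap', norm_smul, hu, Real.norm_of_nonneg (hts j), Real.norm_of_nonneg ht0]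
    ring

variable [FiniteDimensional ℝ K]

lemma isClosedMap_chainInvariant (n : ℕ) :
    IsClosedMap (chainInvariant n : (Fin (n + 1) → K) → K × (Fin n → ℝ)) := by
  have : ProperSpace K := FiniteDimensional.proper ℝ K
  refine (isProperMap_iff_tendsto_cocompact.2 ⟨continuous_chainInvariant n, ?_⟩).isClosedMap
  rw [← Metric.cobounded_eq_cocompact, ← Metric.cobounded_eq_cocompact,
    ← tendsto_norm_atTop_iff_cobounded]
  refine Filter.tendsto_atTop_mono (f := fun a => (‖a‖ - 1) / 3)
    (fun a => by linarith [norm_le_chainInvariant a]) ?_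
  exact (Filter.tendsto_atTop_add_const_right _ (-1) tendsto_norm_cobounded_atTop).atTop_div_const
    (by norm_num)

/-- The invariants identify the orbit space of the chain action with `K × ℝⁿ`. -/
def chainQuotHomeomorph (n : ℕ) : Quot (chainRel K (n + 1)) ≃ₜ K × (Fin n → ℝ) :=
  IsHomeomorph.homeomorph
    (Quot.lift (chainInvariant n) fun _ _ h => chainInvariant_eq_of_chainRel h) <| by
    refine isHomeomorph_iff_continuous_isClosedMap_bijective.2
      ⟨continuous_quot_lift _ (continuous_chainInvariant n), ?_, ?_, ?_⟩
    · exact IsClosedMap.of_comp_surjective Quot.mk_surjective continuous_quot_mk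
        (isClosedMap_chainInvariant n)
    · rintro ⟨a⟩ ⟨b⟩ h
      exact Quot.sound (chainRel_of_chainInvariant_eq h)
    · exact fun y => (surjective_chainInvariant n y).imp' (Quot.mk _) fun _ h => h

end ChainAction

/-- for `k ≥ 2`, the orbit space `ℍ^k/Sp(1)^{k-1}` of the chain action of the
quaternionic torus `Sp(1)^{k-1}` on `ℍ^k` is homeomorphic to `ℝ^{k+3}`. -/
theorem stmt14 (k : ℕ) (hk : 2 ≤ k) :
    Nonempty (Quot (chainRel (Quaternion ℝ) k) ≃ₜ EuclideanSpace ℝ (Fin (k + 3))) := by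
  obtain ⟨n, rfl⟩ : ∃ n, k = n + 1 := ⟨k - 1, by omega⟩
  have h : Module.finrank ℝ (Quaternion ℝ × (Fin n → ℝ)) =
      Module.finrank ℝ (EuclideanSpace ℝ (Fin (n + 1 + 3))) := by
    simp [Module.finrank_prod, Quaternion.finrank_eq_four]
    ring
  exact ⟨(chainQuotHomeomorph n).trans (ContinuousLinearEquiv.ofFinrankEq h).toHomeomorph⟩
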